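/- Let (Ω, Σ, μ) be a probability space, H a real Hilbert space, and (f_n)_{n≥1} a sequence in the Bochner space L¹(μ; H) that is bounded in L¹-norm, i.e. sup_n ∫ ‖f_n‖ dμ < ∞. Then there exist f ∈ L¹(μ; H) and a strictly increasing map φ : ℕ → ℕ such that, setting g_n = f_{φ(n)}, for every strictly increasing map ψ : ℕ → ℕ and every bijection π : ℕ → ℕ, the Cesàro means (1/n) ∑_{k=1}^n g_{ψ(π(k))}(ω) converge in H to f(ω) for μ-almost every ω ∈ Ω. -/

import Mathlib

open MeasureTheory Filter Topology

theorem tendsto_inv_smul_sum_of_exists_subseq {E : Type*} [NormedAddCommGroup E]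
    [NormedSpace ℝ E] {x : ℕ → E} {l : E} {R : ℝ}
    (hnorm : Tendsto (fun n : ℕ => (∑ k ∈ Finset.range n, ‖x k‖) / n) atTop (𝓝 R))
    (hlim : ∀ a : ℝ, 1 < a → ∃ c : ℕ → ℕ, (∀ᶠ n in atTop, (c (n + 1) : ℝ) ≤ a * c n) ∧
      Tendsto c atTop atTop ∧
      Tendsto (fun i => (c i : ℝ)⁻¹ • ∑ k ∈ Finset.range (c i), x k) atTop (𝓝 l)) :
    Tendsto (fun n : ℕ => (n : ℝ)⁻¹ • ∑ k ∈ Finset.range n, x k) atTop (𝓝 l) := by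
  have hR : 0 ≤ R := ge_of_tendsto' hnorm fun n => by positivity
  rw [Metric.tendsto_atTop]
  intro ε hε
  set D : ℝ := R + 3 + ‖l‖ with hD
  have hDpos : 0 < D := by positivity
  obtain ⟨δ, hδ, hδε⟩ : ∃ δ : ℝ, 0 < δ ∧ δ * D < ε :=
    ⟨ε / (2 * D), by positivity, by field_simp; linarith⟩
  obtain ⟨c, hc, hctop, hcl⟩ := hlim (1 + δ) (by linarith)
  obtain ⟨n₀, hn₀⟩ := Metric.tendsto_atTop.1 hnorm δ hδ
  obtain ⟨i₁, hi₁⟩ := Metric.tendsto_atTop.1 hcl δ hδ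
  obtain ⟨i₂, hi₂⟩ := eventually_atTop.1 hc
  obtain ⟨i₃, hi₃⟩ := eventually_atTop.1 (hctop.eventually_ge_atTop (n₀ + 1))
  set i₀ := max i₁ (max i₂ i₃) with hi₀
  refine ⟨c i₀ + 1, fun n hn => ?_⟩
  obtain ⟨i, hi, hin, hni⟩ : ∃ i, i₀ ≤ i ∧ c i ≤ n ∧ n < c (i + 1) := by
    by_contra! hcon
    have hall : ∀ j, c (i₀ + j) ≤ n := by
      intro j
      induction j with
      | zero => rw [add_zero]; omega
      | succ j ih => exact hcon (i₀ + j) (Nat.le_add_right _ _) ih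
    obtain ⟨j, hj⟩ := eventually_atTop.1 (hctop.eventually_gt_atTop n)
    exact absurd (hj (i₀ + j) (by omega)) (by have := hall j; omega)
  have hN0 : n₀ + 1 ≤ c i := hi₃ i (by omega)
  set N := c i with hN
  have hNpos : (0 : ℝ) < N := by exact_mod_cast (by omega : 0 < N)
  have hnpos : (0 : ℝ) < n := by exact_mod_cast (by omega : 0 < n)
  have hNn : (N : ℝ) ≤ n := by exact_mod_cast hin
  have hnN : (n : ℝ) - N ≤ δ * n := by
    have h1 : (n : ℝ) ≤ c (i + 1) := by exact_mod_cast hni.le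
    have h2 := hi₂ i (by omega)
    nlinarith
  have hAn := hn₀ n (by omega)
  have hAN := hn₀ N (by omega)
  have hSN := hi₁ i (by omega)
  set A : ℕ → ℝ := fun n => ∑ k ∈ Finset.range n, ‖x k‖ with hA
  set S : ℕ → E := fun n => ∑ k ∈ Finset.range n, x k with hS
  change dist (A n / n) R < δ at hAn
  change dist (A N / N) R < δ at hAN
  change dist ((N : ℝ)⁻¹ • S N) l < δ at hSN
  change dist ((n : ℝ)⁻¹ • S n) l < ε
  rw [Real.dist_eq, abs_lt] at hAn hAN
  have hAn' : A n ≤ (R + δ) * n := (div_le_iff₀ hnpos).1 (by linarith)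
  have hAN' : (R - δ) * N ≤ A N := (le_div_iff₀ hNpos).1 (by linarith)
  have hdiff : ‖S n - S N‖ ≤ A n - A N := by
    simp only [hS, hA]
    rw [← Finset.sum_Ico_eq_sub _ hin, ← Finset.sum_Ico_eq_sub _ hin]
    exact norm_sum_le _ _
  have key : ∀ m : ℕ, (0 : ℝ) < m → ‖S m - (m : ℝ) • l‖ = m * dist ((m : ℝ)⁻¹ • S m) l := by
    intro m hm
    rw [dist_eq_norm, ← abs_of_pos hm, ← Real.norm_eq_abs, ← norm_smul, smul_sub, smul_smul,
      Real.norm_eq_abs, abs_of_pos hm, mul_inv_cancel₀ hm.ne', one_smul]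
  have hSN' : ‖S N - (N : ℝ) • l‖ ≤ N * δ := by
    rw [key N hNpos]; gcongr
  have htot : ‖S n - (n : ℝ) • l‖ ≤ (A n - A N) + N * δ + (n - N) * ‖l‖ := by
    have : S n - (n : ℝ) • l = (S n - S N) + (S N - (N : ℝ) • l) - ((n : ℝ) - N) • l := by
      rw [sub_smul]; abel
    rw [this]
    refine (norm_sub_le _ _).trans (add_le_add ((norm_add_le _ _).trans
      (add_le_add hdiff hSN')) ?_)
    rw [norm_smul, Real.norm_of_nonneg (by linarith)]
  rw [key n hnpos] at htot
  have : n * dist ((n : ℝ)⁻¹ • S n) l ≤ n * (δ * D) := by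
    refine htot.trans ?_
    have h1 : ((n : ℝ) - N) * ‖l‖ ≤ δ * n * ‖l‖ := by gcongr
    have h2 : ((n : ℝ) - N) * R ≤ δ * n * R := by gcongr
    have h3 : N * δ ≤ n * δ := by gcongr
    rw [hD]
    nlinarith
  exact (le_of_mul_le_mul_left this hnpos).trans_lt hδε

theorem exists_subseq_floor_pow_le {a : ℝ} (ha : 1 < a) : ∃ m : ℕ,
    (∀ᶠ n : ℕ in atTop, (⌊(1 + 1 / ((m : ℝ) + 1)) ^ (n + 1)⌋₊ : ℝ) ≤
      a * ⌊(1 + 1 / ((m : ℝ) + 1)) ^ n⌋₊) := by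
  obtain ⟨m, hm⟩ := exists_nat_one_div_lt (sub_pos.2 ha)
  refine ⟨m, ?_⟩
  set b : ℝ := 1 + 1 / ((m : ℝ) + 1) with hb
  have hb1 : 1 < b := by rw [hb]; linarith [Nat.one_div_pos_of_nat (α := ℝ) (n := m)]
  have hpow := tendsto_pow_atTop_atTop_of_one_lt hb1
  have hfl : Tendsto (fun n : ℕ => (⌊b ^ n⌋₊ : ℝ) / b ^ n) atTop (𝓝 1) :=
    tendsto_nat_floor_div_atTop.comp hpow
  have hlt : b / a < 1 := (div_lt_one (by linarith)).2 (by linarith)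
  filter_upwards [hfl.eventually (eventually_ge_nhds hlt)] with n hn
  have hbn : 0 < b ^ n := by positivity
  rw [le_div_iff₀ hbn, div_mul_eq_mul_div, div_le_iff₀ (by linarith)] at hn
  calc (⌊b ^ (n + 1)⌋₊ : ℝ) ≤ b ^ (n + 1) := Nat.floor_le (by positivity)
    _ = b * b ^ n := by ring
    _ ≤ a * ⌊b ^ n⌋₊ := by linarith

theorem one_le_floor_pow {c : ℝ} (hc : 1 < c) (i : ℕ) : 1 ≤ ⌊c ^ i⌋₊ := by
  rw [Nat.one_le_floor_iff]; exact one_le_pow₀ hc.le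

/-- Averages along geometric scales of a sequence with `∑ v k / (k + 1) ^ 2 < ∞`. -/
theorem summable_floor_pow_sum {v : ℕ → ℝ} (hv : ∀ k, 0 ≤ v k)
    (hs : Summable fun k => v k / ((k : ℝ) + 1) ^ 2) {c : ℝ} (hc : 1 < c) :
    Summable fun i : ℕ => (∑ k ∈ Finset.range ⌊c ^ i⌋₊, v k) / (⌊c ^ i⌋₊ : ℝ) ^ 2 := by
  refine summable_of_sum_range_le (c := (4 * (c ^ 5 * (c - 1)⁻¹ ^ 3)) *
    ∑' k, v k / ((k : ℝ) + 1) ^ 2) (fun i => div_nonneg (Finset.sum_nonneg fun k _ => hv k) (by positivity)) fun n => ?_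
  have hC : 0 ≤ 4 * (c ^ 5 * (c - 1)⁻¹ ^ 3) := by
    have := sub_pos.2 hc
    positivity
  set M := (Finset.range n).sup fun i => ⌊c ^ i⌋₊ with hM
  have hiM : ∀ i ∈ Finset.range n, ⌊c ^ i⌋₊ ≤ M := fun i hi =>
    Finset.le_sup (f := fun i => ⌊c ^ i⌋₊) hi
  calc ∑ i ∈ Finset.range n, (∑ k ∈ Finset.range ⌊c ^ i⌋₊, v k) / (⌊c ^ i⌋₊ : ℝ) ^ 2
      = ∑ i ∈ Finset.range n, ∑ k ∈ Finset.range ⌊c ^ i⌋₊,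
          v k * (1 / (⌊c ^ i⌋₊ : ℝ) ^ 2) := by
        refine Finset.sum_congr rfl fun i _ => ?_
        rw [← Finset.sum_mul, mul_one_div]
    _ = ∑ k ∈ Finset.range M, ∑ i ∈ Finset.range n with ((k : ℝ) + 1 / 2 < ⌊c ^ i⌋₊),
          v k * (1 / (⌊c ^ i⌋₊ : ℝ) ^ 2) := by
        refine Finset.sum_comm' fun i k => ?_
        have hk : ((k : ℝ) + 1 / 2 < ⌊c ^ i⌋₊) ↔ k < ⌊c ^ i⌋₊ := by
          constructor
          · intro h
            by_contra! h'
            have : ((⌊c ^ i⌋₊ : ℕ) : ℝ) ≤ k := by exact_mod_cast h'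
            linarith
          · intro h
            have : (k : ℝ) + 1 ≤ ((⌊c ^ i⌋₊ : ℕ) : ℝ) := by exact_mod_cast h
            linarith
        rw [Finset.mem_filter, hk, Finset.mem_range, Finset.mem_range, Finset.mem_range]
        constructor
        · rintro ⟨h1, h2⟩
          exact ⟨⟨h1, h2⟩, h2.trans_le (hiM i (Finset.mem_range.2 h1))⟩
        · rintro ⟨⟨h1, h2⟩, -⟩
          exact ⟨h1, h2⟩
    _ ≤ ∑ k ∈ Finset.range M, (4 * (c ^ 5 * (c - 1)⁻¹ ^ 3)) * (v k / ((k : ℝ) + 1) ^ 2) := by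
        refine Finset.sum_le_sum fun k _ => ?_
        rw [← Finset.mul_sum]
        have h := sum_div_nat_floor_pow_sq_le_div_sq n (j := (k : ℝ) + 1 / 2) (by positivity) hc
        have h2 : c ^ 5 * (c - 1)⁻¹ ^ 3 / ((k : ℝ) + 1 / 2) ^ 2 ≤
            (4 * (c ^ 5 * (c - 1)⁻¹ ^ 3)) / ((k : ℝ) + 1) ^ 2 := by
          rw [div_le_div_iff₀ (by positivity) (by positivity)]
          have hk : (0 : ℝ) ≤ k := by positivity
          have : ((k : ℝ) + 1) ^ 2 ≤ 4 * ((k : ℝ) + 1 / 2) ^ 2 := by nlinarith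
          nlinarith
        calc _ ≤ v k * ((4 * (c ^ 5 * (c - 1)⁻¹ ^ 3)) / ((k : ℝ) + 1) ^ 2) :=
              mul_le_mul_of_nonneg_left (h.trans h2) (hv k)
          _ = _ := by ring
    _ ≤ _ := by
        rw [← Finset.mul_sum]
        refine mul_le_mul_of_nonneg_left (hs.sum_le_tsum _ fun k _ => ?_) hC
        have := hv k
        positivity

theorem summable_inv_floor_pow_sq {c : ℝ} (hc : 1 < c) :
    Summable fun i : ℕ => 1 / (⌊c ^ i⌋₊ : ℝ) ^ 2 := by
  refine summable_of_sum_range_le (c := c ^ 5 * (c - 1)⁻¹ ^ 3 / (1 / 2 : ℝ) ^ 2)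
    (fun i => by positivity) fun n => ?_
  have h := sum_div_nat_floor_pow_sq_le_div_sq n (j := 1 / 2) (by norm_num) hc
  rwa [Finset.filter_true_of_mem] at h
  intro i _
  have : (1 : ℝ) ≤ ⌊c ^ i⌋₊ := by exact_mod_cast one_le_floor_pow hc i
  linarith

theorem summable_div_sq_mul_sum_range {q : ℕ → ℝ} (hq : ∀ j, 0 ≤ q j)
    (hs : Summable fun j : ℕ => ((j : ℝ) + 1) * q j) :
    Summable fun k : ℕ => (∑ j ∈ Finset.range k, ((j : ℝ) + 1) ^ 2 * q j) / ((k : ℝ) + 1) ^ 2 := by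
  refine summable_of_sum_range_le (c := 2 * ∑' j : ℕ, ((j : ℝ) + 1) * q j)
    (fun k => div_nonneg (Finset.sum_nonneg fun j _ => mul_nonneg (by positivity) (hq j))
      (by positivity)) fun n => ?_
  calc ∑ k ∈ Finset.range n, (∑ j ∈ Finset.range k, ((j : ℝ) + 1) ^ 2 * q j) / ((k : ℝ) + 1) ^ 2
      = ∑ k ∈ Finset.range n, ∑ j ∈ Finset.range k,
          ((j : ℝ) + 1) ^ 2 * q j * (((k : ℝ) + 1) ^ 2)⁻¹ := by
        refine Finset.sum_congr rfl fun i _ => ?_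
        rw [← Finset.sum_mul, div_eq_mul_inv]
    _ ≤ ∑ k ∈ Finset.range n, ∑ j ∈ Finset.range k,
          ((j : ℝ) + 1) ^ 2 * q j * ((k : ℝ) ^ 2)⁻¹ := by
        refine Finset.sum_le_sum fun k _ => Finset.sum_le_sum fun j hj => ?_
        have hk : (0 : ℝ) < k := by exact_mod_cast (Nat.zero_le j).trans_lt (Finset.mem_range.1 hj)
        have := hq j
        gcongr
        linarith
    _ = ∑ j ∈ Finset.range n, ∑ k ∈ Finset.Ioo j n,
          ((j : ℝ) + 1) ^ 2 * q j * ((k : ℝ) ^ 2)⁻¹ := by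
        refine Finset.sum_comm' fun k j => ?_
        simp only [Finset.mem_range, Finset.mem_Ioo]
        omega
    _ ≤ ∑ j ∈ Finset.range n, 2 * (((j : ℝ) + 1) * q j) := by
        refine Finset.sum_le_sum fun j _ => ?_
        rw [← Finset.mul_sum]
        calc _ ≤ ((j : ℝ) + 1) ^ 2 * q j * (2 / ((j : ℝ) + 1)) :=
              mul_le_mul_of_nonneg_left (sum_Ioo_inv_sq_le j n)
                (mul_nonneg (by positivity) (hq j))
          _ = _ := by field_simp
    _ ≤ _ := by
        rw [← Finset.mul_sum]
        exact mul_le_mul_of_nonneg_left (hs.sum_le_tsum _ fun j _ =>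
          mul_nonneg (by positivity) (hq j)) (by norm_num)

theorem summable_sum_Ico {q : ℕ → ℝ} (hq : ∀ j, 0 ≤ q j)
    (hs : Summable fun j : ℕ => ((j : ℝ) + 1) * q j) (M : ℕ → ℕ) :
    Summable fun k : ℕ => ∑ j ∈ Finset.Ico k (M k), q j := by
  refine summable_of_sum_range_le (c := ∑' j : ℕ, ((j : ℝ) + 1) * q j)
    (fun k => Finset.sum_nonneg fun j _ => hq j) fun n => ?_
  set S := (Finset.range n).sup M
  calc ∑ k ∈ Finset.range n, ∑ j ∈ Finset.Ico k (M k), q j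
      ≤ ∑ k ∈ Finset.range n, ∑ j ∈ Finset.Ico k S, q j := by
        refine Finset.sum_le_sum fun k hk => Finset.sum_le_sum_of_subset_of_nonneg
          (Finset.Ico_subset_Ico_right (Finset.le_sup hk)) fun j _ _ => hq j
    _ ≤ ∑ j ∈ Finset.range S, ∑ k ∈ Finset.range (j + 1), q j := by
        rw [Finset.sum_comm' (t' := Finset.range S)
          (s' := fun j => (Finset.range n).filter fun k => k ≤ j)]
        · refine Finset.sum_le_sum fun j _ => Finset.sum_le_sum_of_subset_of_nonneg ?_
            fun k _ _ => hq j
          intro k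
          simp only [Finset.mem_filter, Finset.mem_range]
          omega
        · intro k j
          simp only [Finset.mem_filter, Finset.mem_range, Finset.mem_Ico]
          omega
    _ = ∑ j ∈ Finset.range S, ((j : ℝ) + 1) * q j := by simp
    _ ≤ _ := hs.sum_le_tsum _ fun j _ => mul_nonneg (by positivity) (hq j)

/-- The set where the integer part of `‖f‖` is `j`. -/
def normShell {Ω H : Type*} [NormedAddCommGroup H] (f : Ω → H) (j : ℕ) : Set Ω :=
  {ω | ⌊‖f ω‖⌋₊ = j}

/-- The function `f`, set to zero where `K ≤ ‖f‖`. -/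
noncomputable def normTrunc {Ω H : Type*} [NormedAddCommGroup H] (f : Ω → H) (K : ℕ) : Ω → H :=
  {ω | ⌊‖f ω‖⌋₊ < K}.indicator f

section Truncation

variable {Ω H : Type*} [NormedAddCommGroup H]

theorem norm_normTrunc_le (f : Ω → H) (K : ℕ) (ω : Ω) : ‖normTrunc f K ω‖ ≤ K := by
  unfold normTrunc
  by_cases h : ω ∈ {ω | ⌊‖f ω‖⌋₊ < K}
  · rw [Set.indicator_of_mem h]
    exact (Nat.floor_lt (norm_nonneg _)).1 h |>.le
  · rw [Set.indicator_of_notMem h]; simp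

theorem norm_normTrunc_succ_sub_le (f : Ω → H) (K : ℕ) (ω : Ω) :
    ‖normTrunc f (K + 1) ω - normTrunc f K ω‖ ≤
      (normShell f K).indicator (fun _ => (K : ℝ) + 1) ω := by
  rcases lt_trichotomy ⌊‖f ω‖⌋₊ K with h | h | h
  · have h' : ⌊‖f ω‖⌋₊ < K + 1 := by omega
    simp [normTrunc, normShell, h, h', h.ne, -Order.lt_add_one_iff]
  · have h' : ‖f ω‖ < ⌊‖f ω‖⌋₊ + 1 := Nat.lt_floor_add_one _
    rw [h] at h'
    simp [normTrunc, normShell, h, h'.le]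
  · have h' : ¬ ⌊‖f ω‖⌋₊ < K + 1 := by omega
    simp [normTrunc, normShell, h.not_gt, h', h.ne', -Order.lt_add_one_iff]

theorem sq_norm_normTrunc_le (f : Ω → H) (K : ℕ) (ω : Ω) :
    ‖normTrunc f K ω‖ ^ 2 ≤
      ∑ j ∈ Finset.range K, (normShell f j).indicator (fun _ => ((j : ℝ) + 1) ^ 2) ω := by
  have hnn : ∀ j ∈ Finset.range K,
      0 ≤ (normShell f j).indicator (fun _ => ((j : ℝ) + 1) ^ 2) ω := fun j _ =>
    Set.indicator_nonneg (fun _ _ => by positivity) _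
  by_cases h : ⌊‖f ω‖⌋₊ < K
  · refine le_trans ?_ (Finset.single_le_sum hnn (Finset.mem_range.2 h))
    simp only [normTrunc, normShell, Set.mem_ofPred_eq, h, Set.indicator_of_mem]
    gcongr
    exact (Nat.lt_floor_add_one _).le
  · simpa [normTrunc, h] using Finset.sum_nonneg hnn

variable [MeasurableSpace Ω] {μ : Measure Ω} {f : Ω → H}

theorem measurable_floor_norm (hf : StronglyMeasurable f) : Measurable fun ω => ⌊‖f ω‖⌋₊ :=
  hf.norm.measurable.nat_floor

theorem measurableSet_normShell (hf : StronglyMeasurable f) (j : ℕ) :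
    MeasurableSet (normShell f j) :=
  measurable_floor_norm hf (measurableSet_singleton j)

theorem stronglyMeasurable_normTrunc (hf : StronglyMeasurable f) (K : ℕ) :
    StronglyMeasurable (normTrunc f K) :=
  hf.indicator (measurable_floor_norm hf measurableSet_Iio)

theorem memLp_normTrunc [IsFiniteMeasure μ] (hf : StronglyMeasurable f) (K : ℕ) (p : ENNReal) :
    MemLp (normTrunc f K) p μ :=
  MemLp.of_bound (stronglyMeasurable_normTrunc hf K).aestronglyMeasurable K
    (Eventually.of_forall (norm_normTrunc_le f K))

theorem integral_norm_normTrunc_succ_sub_le [IsFiniteMeasure μ] (hf : StronglyMeasurable f)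
    (K : ℕ) : ∫ ω, ‖normTrunc f (K + 1) ω - normTrunc f K ω‖ ∂μ ≤
      ((K : ℝ) + 1) * μ.real (normShell f K) := by
  calc _ ≤ ∫ ω, (normShell f K).indicator (fun _ => (K : ℝ) + 1) ω ∂μ := by
        refine integral_mono (((memLp_normTrunc hf _ 1).sub (memLp_normTrunc hf _ 1)).integrable
          le_rfl).norm ((integrable_const _).indicator (measurableSet_normShell hf K)) ?_
        exact norm_normTrunc_succ_sub_le f K
    _ = _ := by
        rw [integral_indicator_const _ (measurableSet_normShell hf K), smul_eq_mul, mul_comm]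

theorem integral_sq_norm_normTrunc_le [IsFiniteMeasure μ] (hf : StronglyMeasurable f) (K : ℕ) :
    ∫ ω, ‖normTrunc f K ω‖ ^ 2 ∂μ ≤
      ∑ j ∈ Finset.range K, ((j : ℝ) + 1) ^ 2 * μ.real (normShell f j) := by
  have hint : ∀ j ∈ Finset.range K, Integrable
      ((normShell f j).indicator (fun _ => ((j : ℝ) + 1) ^ 2)) μ := fun j _ =>
    (integrable_const _).indicator (measurableSet_normShell hf j)
  calc _ ≤ ∫ ω, ∑ j ∈ Finset.range K,
          (normShell f j).indicator (fun _ => ((j : ℝ) + 1) ^ 2) ω ∂μ := by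
        refine integral_mono (memLp_normTrunc hf K 2).integrable_norm_pow'
          (integrable_finsetSum _ hint) ?_
        exact sq_norm_normTrunc_le f K
    _ = _ := by
        rw [integral_finsetSum _ hint]
        refine Finset.sum_congr rfl fun j _ => ?_
        rw [integral_indicator_const _ (measurableSet_normShell hf j), smul_eq_mul, mul_comm]

theorem sum_mul_measureReal_normShell_le [IsProbabilityMeasure μ] (hf : StronglyMeasurable f)
    (hfi : Integrable f μ) (N : ℕ) :
    ∑ j ∈ Finset.range N, ((j : ℝ) + 1) * μ.real (normShell f j) ≤ ∫ ω, ‖f ω‖ ∂μ + 1 := by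
  have hint : ∀ j ∈ Finset.range N, Integrable
      ((normShell f j).indicator (fun _ => (j : ℝ) + 1)) μ := fun j _ =>
    (integrable_const _).indicator (measurableSet_normShell hf j)
  calc _ = ∫ ω, ∑ j ∈ Finset.range N,
          (normShell f j).indicator (fun _ => (j : ℝ) + 1) ω ∂μ := by
        rw [integral_finsetSum _ hint]
        refine Finset.sum_congr rfl fun j _ => ?_
        rw [integral_indicator_const _ (measurableSet_normShell hf j), smul_eq_mul, mul_comm]
    _ ≤ ∫ ω, (‖f ω‖ + 1) ∂μ := by
        refine integral_mono (integrable_finsetSum _ hint) (hfi.norm.add (integrable_const _)) ?_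
        intro ω
        simp only [normShell, Set.indicator_apply, Set.mem_ofPred_eq, Finset.sum_ite_eq,
          Finset.mem_range]
        split_ifs
        · gcongr
          exact Nat.floor_le (norm_nonneg _)
        · positivity
    _ = _ := by rw [integral_add hfi.norm (integrable_const _)]; simp

theorem measureReal_le_floor_norm_le [IsFiniteMeasure μ] (hfi : Integrable f μ) (K : ℕ) {M : ℕ}
    (hM : 0 < M) : μ.real {ω | K ≤ ⌊‖f ω‖⌋₊} ≤
      ∑ j ∈ Finset.Ico K M, μ.real (normShell f j) + (∫ ω, ‖f ω‖ ∂μ) / M := by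
  have hM' : (0 : ℝ) < M := by exact_mod_cast hM
  calc μ.real {ω | K ≤ ⌊‖f ω‖⌋₊}
      ≤ μ.real ((⋃ j ∈ Finset.Ico K M, normShell f j) ∪ {ω | (M : ℝ) ≤ ‖f ω‖}) := by
        refine measureReal_mono fun ω hω => ?_
        by_cases h : ⌊‖f ω‖⌋₊ < M
        · left
          simp only [Set.mem_iUnion]
          exact ⟨_, Finset.mem_Ico.2 ⟨hω, h⟩, rfl⟩
        · right
          exact (Nat.le_floor_iff (norm_nonneg _)).1 (not_lt.1 h)
    _ ≤ μ.real (⋃ j ∈ Finset.Ico K M, normShell f j) + μ.real {ω | (M : ℝ) ≤ ‖f ω‖} :=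
        measureReal_union_le _ _
    _ ≤ _ := by
        gcongr
        · exact measureReal_biUnion_finset_le _ _
        · rw [le_div_iff₀ hM', mul_comm]
          exact mul_meas_ge_le_integral_of_nonneg (Eventually.of_forall fun _ => norm_nonneg _)
            hfi.norm _

end Truncation

section WeakLimit

theorem exists_tendsto_inner {E : Type*} [NormedAddCommGroup E] [InnerProductSpace ℝ E]
    [CompleteSpace E] {ι : Type*} (U : Ultrafilter ι) {x : ι → E} {M : ℝ} (hx : ∀ n, ‖x n‖ ≤ M) :
    ∃ w : E, ∀ y, Tendsto (fun n => inner ℝ (x n) y) U (𝓝 (inner ℝ w y)) := by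
  set D := InnerProductSpace.toDual ℝ E
  obtain ⟨w, -, hw⟩ := (WeakDual.isCompact_closedBall (𝕜 := ℝ) (E := E) 0 M).ultrafilter_le_nhds'
    (U.map fun n => StrongDual.toWeakDual (D (x n))) (by
      refine Filter.mem_map.2 (Filter.univ_mem' fun n => ?_)
      simpa [D] using hx n)
  refine ⟨D.symm (WeakDual.toStrongDual w), fun y => ?_⟩
  have h := (WeakDual.eval_continuous (𝕜 := ℝ) y).tendsto w |>.mono_left hw
  have hy : inner ℝ (D.symm (WeakDual.toStrongDual w)) y = w y := by
    simp [D]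
  rw [hy]
  exact h

variable {Ω H : Type*} [MeasurableSpace Ω] {μ : Measure Ω} [NormedAddCommGroup H]
  [InnerProductSpace ℝ H]

theorem MeasureTheory.MemLp.integrable_inner_of_two {u v : Ω → H} (hu : MemLp u 2 μ) (hv : MemLp v 2 μ) :
    Integrable (fun ω => inner ℝ (u ω) (v ω)) μ := by
  refine (L2.integrable_inner (𝕜 := ℝ) hu.toLp hv.toLp).congr ?_
  filter_upwards [hu.coeFn_toLp, hv.coeFn_toLp] with ω h1 h2
  rw [h1, h2]

theorem inner_toLp {u v : Ω → H} (hu : MemLp u 2 μ) (hv : MemLp v 2 μ) :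
    inner ℝ hu.toLp hv.toLp = ∫ ω, inner ℝ (u ω) (v ω) ∂μ := by
  rw [L2.inner_def]
  refine integral_congr_ae ?_
  filter_upwards [hu.coeFn_toLp, hv.coeFn_toLp] with ω h1 h2
  rw [h1, h2]

/-- Convergence of `u` to `w` along `l`, tested against square-integrable functions. -/
def TendstoWeakL2 {ι : Type*} (μ : Measure Ω) (u : ι → Ω → H) (l : Filter ι) (w : Ω → H) : Prop :=
  ∀ y : Ω → H, MemLp y 2 μ →
    Tendsto (fun n => ∫ ω, inner ℝ (u n ω) (y ω) ∂μ) l (𝓝 (∫ ω, inner ℝ (w ω) (y ω) ∂μ))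

theorem exists_tendstoWeakL2 [CompleteSpace H] [IsProbabilityMeasure μ] {ι : Type*}
    (U : Ultrafilter ι) {u : ι → Ω → H} {M : ℝ} (hu : ∀ n, AEStronglyMeasurable (u n) μ)
    (hM : ∀ n ω, ‖u n ω‖ ≤ M) : ∃ w, MemLp w 2 μ ∧ TendstoWeakL2 μ u U w := by
  have hmem : ∀ n, MemLp (u n) 2 μ := fun n =>
    MemLp.of_bound (hu n) M (Eventually.of_forall (hM n))
  obtain ⟨w, hw⟩ := exists_tendsto_inner U (x := fun n => (hmem n).toLp) (M := max M 0) fun n => by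
    rw [Lp.norm_toLp]
    refine ENNReal.toReal_le_of_le_ofReal (le_max_right _ _) ?_
    refine (eLpNorm_le_of_ae_bound (C := M) (Eventually.of_forall (hM n))).trans ?_
    simp
  refine ⟨w, Lp.memLp w, fun y hy => ?_⟩
  have h := hw hy.toLp
  simp only [inner_toLp] at h
  rw [L2.inner_def] at h
  convert h using 2
  refine integral_congr_ae ?_
  filter_upwards [hy.coeFn_toLp] with ω h1
  rw [h1]

variable {ι : Type*} {l : Filter ι} {u v : ι → Ω → H} {w z : Ω → H}

theorem TendstoWeakL2.sub (hu : ∀ n, MemLp (u n) 2 μ) (hv : ∀ n, MemLp (v n) 2 μ)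
    (hw : MemLp w 2 μ) (hz : MemLp z 2 μ) (h : TendstoWeakL2 μ u l w)
    (h' : TendstoWeakL2 μ v l z) :
    TendstoWeakL2 μ (fun n ω => u n ω - v n ω) l (fun ω => w ω - z ω) := by
  intro y hy
  simp only [inner_sub_left]
  rw [integral_sub (hw.integrable_inner_of_two hy) (hz.integrable_inner_of_two hy)]
  simp only [fun n => integral_sub ((hu n).integrable_inner_of_two hy) ((hv n).integrable_inner_of_two hy)]
  exact (h y hy).sub (h' y hy)

theorem TendstoWeakL2.integral_sq_norm_le [l.NeBot] [IsFiniteMeasure μ] (hu : ∀ n, MemLp (u n) 2 μ) (hw : MemLp w 2 μ)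
    (h : TendstoWeakL2 μ u l w) {b : ι → ℝ} {B : ℝ} (hb : Tendsto b l (𝓝 B))
    (hub : ∀ n, ∫ ω, ‖u n ω‖ ^ 2 ∂μ ≤ b n) : ∫ ω, ‖w ω‖ ^ 2 ∂μ ≤ B := by
  have h1 := h w hw
  simp only [real_inner_self_eq_norm_sq] at h1
  have h2 : Tendsto (fun n => (b n + ∫ ω, ‖w ω‖ ^ 2 ∂μ) / 2) l
      (𝓝 ((B + ∫ ω, ‖w ω‖ ^ 2 ∂μ) / 2)) := (hb.add_const _).div_const _
  have h3 := le_of_tendsto_of_tendsto' h1 h2 fun n => by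
    calc ∫ ω, inner ℝ (u n ω) (w ω) ∂μ ≤ ∫ ω, (‖u n ω‖ ^ 2 + ‖w ω‖ ^ 2) / 2 ∂μ := by
          refine integral_mono ((hu n).integrable_inner_of_two hw)
            (((hu n).integrable_norm_pow'.add hw.integrable_norm_pow').div_const _) fun ω => ?_
          have := real_inner_le_norm (u n ω) (w ω)
          have := sq_nonneg (‖u n ω‖ - ‖w ω‖)
          dsimp only
          nlinarith
      _ = (∫ ω, ‖u n ω‖ ^ 2 ∂μ + ∫ ω, ‖w ω‖ ^ 2 ∂μ) / 2 := by
          rw [integral_div, integral_add (hu n).integrable_norm_pow' hw.integrable_norm_pow']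
      _ ≤ _ := by gcongr; exact hub n
  linarith

theorem TendstoWeakL2.integral_norm_le [l.NeBot] [IsFiniteMeasure μ] (hu : ∀ n, MemLp (u n) 2 μ)
    (hw : MemLp w 2 μ) (h : TendstoWeakL2 μ u l w) {b : ι → ℝ} {B : ℝ} (hb : Tendsto b l (𝓝 B))
    (hub : ∀ n, ∫ ω, ‖u n ω‖ ∂μ ≤ b n) : ∫ ω, ‖w ω‖ ∂μ ≤ B := by
  have hbound : ∀ ω, ‖‖w ω‖⁻¹ • w ω‖ ≤ 1 := fun ω => by
    rw [norm_smul, norm_inv, norm_norm]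
    exact inv_mul_le_one
  have hs : MemLp (fun ω => ‖w ω‖⁻¹ • w ω) 2 μ :=
    MemLp.of_bound (hw.1.norm.aemeasurable.inv.aestronglyMeasurable.smul hw.1) 1
      (Eventually.of_forall hbound)
  have h1 := h _ hs
  have hself : ∀ ω, inner ℝ (w ω) (‖w ω‖⁻¹ • w ω) = ‖w ω‖ := fun ω => by
    rw [inner_smul_right, real_inner_self_eq_norm_sq]
    rcases eq_or_ne ‖w ω‖ 0 with h0 | h0
    · simp [h0]
    · field_simp
  simp only [hself] at h1
  refine le_of_tendsto_of_tendsto' h1 hb fun n => le_trans ?_ (hub n)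
  refine integral_mono ((hu n).integrable_inner_of_two hs) ((hu n).integrable one_le_two).norm
    fun ω => ?_
  exact (real_inner_le_norm _ _).trans
    (mul_le_of_le_one_right (norm_nonneg _) (hbound ω))

end WeakLimit

section QuasiOrthogonal

variable {Ω H : Type*} [MeasurableSpace Ω] {μ : Measure Ω} [NormedAddCommGroup H]

theorem ae_summable_norm_of_summable_integral_norm {u : ℕ → Ω → H} (hu : ∀ i, Integrable (u i) μ)
    (hs : Summable fun i => ∫ ω, ‖u i ω‖ ∂μ) : ∀ᵐ ω ∂μ, Summable fun i => ‖u i ω‖ := by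
  refine summable_norm_of_tsum_eLpNorm_ne_top le_rfl (fun i => (hu i).1) ?_
  simp only [eLpNorm_one_eq_lintegral_enorm, fun i => (ofReal_integral_norm_eq_lintegral_enorm
    (hu i)).symm]
  exact hs.tsum_ofReal_ne_top

theorem integrable_of_ae_hasSum {u : ℕ → Ω → H} {F : Ω → H} (hu : ∀ i, Integrable (u i) μ)
    (hs : Summable fun i => ∫ ω, ‖u i ω‖ ∂μ)
    (hF : ∀ᵐ ω ∂μ, HasSum (fun i => u i ω) (F ω)) : Integrable F μ := by
  refine ⟨aestronglyMeasurable_of_tendsto_ae (u := atTop)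
    (f := fun n ω => ∑ i ∈ Finset.range n, u i ω)
    (fun n => Finset.aestronglyMeasurable_fun_sum _ fun i _ => (hu i).1) ?_, ?_⟩
  · filter_upwards [hF] with ω h using h.tendsto_sum_nat
  · rw [hasFiniteIntegral_iff_enorm]
    calc ∫⁻ ω, ‖F ω‖ₑ ∂μ ≤ ∫⁻ ω, ∑' i, ‖u i ω‖ₑ ∂μ := by
          refine lintegral_mono_ae ?_
          filter_upwards [hF] with ω h
          rw [← h.tsum_eq]
          exact enorm_tsum_le_tsum_enorm
      _ = ∑' i, ∫⁻ ω, ‖u i ω‖ₑ ∂μ := lintegral_tsum fun i => (hu i).1.enorm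
      _ < ⊤ := by
          simp only [fun i => (ofReal_integral_norm_eq_lintegral_enorm (hu i)).symm]
          exact hs.tsum_ofReal_lt_top

variable [InnerProductSpace ℝ H]

theorem integral_sq_norm_sum_le {Z : ℕ → Ω → H} (hZ : ∀ k, MemLp (Z k) 2 μ) {v e : ℕ → ℝ}
    (he : ∀ k, 0 ≤ e k) (hes : Summable e) (hv : ∀ k, ∫ ω, ‖Z k ω‖ ^ 2 ∂μ ≤ v k)
    (hort : ∀ k l, k ≠ l → |∫ ω, inner ℝ (Z k ω) (Z l ω) ∂μ| ≤ e k * e l) (N : ℕ) :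
    ∫ ω, ‖∑ k ∈ Finset.range N, Z k ω‖ ^ 2 ∂μ ≤ ∑ k ∈ Finset.range N, v k + (∑' k, e k) ^ 2 := by
  have hexp : ∀ ω, ‖∑ k ∈ Finset.range N, Z k ω‖ ^ 2 =
      ∑ k ∈ Finset.range N, ∑ l ∈ Finset.range N, inner ℝ (Z k ω) (Z l ω) := fun ω => by
    rw [← real_inner_self_eq_norm_sq, sum_inner]
    simp only [inner_sum]
  simp only [hexp]
  rw [integral_finsetSum _ fun k _ => integrable_finsetSum _ fun l _ =>
    (hZ k).integrable_inner_of_two (hZ l)]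
  simp only [fun k => integral_finsetSum (Finset.range N) fun l _ =>
    (hZ k).integrable_inner_of_two (hZ l)]
  calc ∑ k ∈ Finset.range N, ∑ l ∈ Finset.range N, ∫ ω, inner ℝ (Z k ω) (Z l ω) ∂μ
      ≤ ∑ k ∈ Finset.range N, ∑ l ∈ Finset.range N, ((if k = l then v k else 0) + e k * e l) := by
        refine Finset.sum_le_sum fun k _ => Finset.sum_le_sum fun l _ => ?_
        split_ifs with hkl
        · subst hkl
          simp only [real_inner_self_eq_norm_sq]
          have := mul_nonneg (he k) (he k)
          linarith [hv k]
        · rw [zero_add]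
          exact (le_abs_self _).trans (hort k l hkl)
    _ = ∑ k ∈ Finset.range N, v k + (∑ k ∈ Finset.range N, e k) ^ 2 := by
        simp only [Finset.sum_add_distrib, Finset.sum_ite_eq, sq, Finset.sum_mul_sum]
        congr 1
        exact Finset.sum_congr rfl fun k hk => by rw [if_pos hk]
    _ ≤ _ := by
        gcongr
        · exact Finset.sum_nonneg fun k _ => he k
        · exact hes.sum_le_tsum _ fun k _ => he k

/-- A strong law of large numbers along geometric scales for quasi-orthogonal sequences. -/
theorem ae_tendsto_floor_pow_of_quasiOrthogonal [IsFiniteMeasure μ] {Z : ℕ → Ω → H}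
    (hZ : ∀ k, MemLp (Z k) 2 μ) {v e : ℕ → ℝ}
    (he : ∀ k, 0 ≤ e k) (hes : Summable e) (hv : ∀ k, ∫ ω, ‖Z k ω‖ ^ 2 ∂μ ≤ v k)
    (hort : ∀ k l, k ≠ l → |∫ ω, inner ℝ (Z k ω) (Z l ω) ∂μ| ≤ e k * e l)
    (hvs : Summable fun k => v k / ((k : ℝ) + 1) ^ 2) {c : ℝ} (hc : 1 < c) :
    ∀ᵐ ω ∂μ, Tendsto (fun i : ℕ => (⌊c ^ i⌋₊ : ℝ)⁻¹ • ∑ k ∈ Finset.range ⌊c ^ i⌋₊, Z k ω)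
      atTop (𝓝 0) := by
  have hv0 : ∀ k, 0 ≤ v k := fun k => (integral_nonneg fun ω => by positivity).trans (hv k)
  set Y : ℕ → Ω → H := fun i ω => (⌊c ^ i⌋₊ : ℝ)⁻¹ • ∑ k ∈ Finset.range ⌊c ^ i⌋₊, Z k ω with hY
  have hYmem : ∀ i, MemLp (Y i) 2 μ := fun i =>
    (memLp_finsetSum _ fun k _ => hZ k).const_smul _
  have hYint : ∀ i, ∫ ω, ‖‖Y i ω‖ ^ 2‖ ∂μ ≤
      (∑ k ∈ Finset.range ⌊c ^ i⌋₊, v k) / (⌊c ^ i⌋₊ : ℝ) ^ 2 +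
        (∑' k, e k) ^ 2 * (1 / (⌊c ^ i⌋₊ : ℝ) ^ 2) := fun i => by
    have h := integral_sq_norm_sum_le hZ he hes hv hort ⌊c ^ i⌋₊
    have h2 : ∀ ω, ‖‖Y i ω‖ ^ 2‖ = (1 / (⌊c ^ i⌋₊ : ℝ) ^ 2) *
        ‖∑ k ∈ Finset.range ⌊c ^ i⌋₊, Z k ω‖ ^ 2 := fun ω => by
      rw [hY, norm_pow, norm_norm, norm_smul, mul_pow, norm_inv, inv_pow, one_div]
      simp
    simp only [h2]
    rw [integral_const_mul]
    calc _ ≤ (1 / (⌊c ^ i⌋₊ : ℝ) ^ 2) * (∑ k ∈ Finset.range ⌊c ^ i⌋₊, v k + (∑' k, e k) ^ 2) := by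
          gcongr
      _ = _ := by ring
  have hsum : Summable fun i => ∫ ω, ‖‖Y i ω‖ ^ 2‖ ∂μ :=
    ((summable_floor_pow_sum hv0 hvs hc).add
      ((summable_inv_floor_pow_sq hc).mul_left _)).of_nonneg_of_le
      (fun i => integral_nonneg fun ω => norm_nonneg _) hYint
  filter_upwards [ae_summable_norm_of_summable_integral_norm
    (fun i => (hYmem i).integrable_norm_pow') hsum] with ω hω
  have h0 := hω.tendsto_atTop_zero
  simp only [norm_pow, norm_norm] at h0
  rw [tendsto_zero_iff_norm_tendsto_zero]
  have := h0.sqrt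
  simpa [Real.sqrt_sq] using this

end QuasiOrthogonal

section Selection

theorem exists_strictMono_of_eventually {U : Filter ℕ} [U.NeBot] (hU : U ≤ atTop)
    {P : ℕ → ℕ → Prop} (hP : ∀ i, ∀ᶠ b in U, P i b) {Q : ℕ → ℕ → ℕ → Prop}
    (hQ : ∀ a i, ∀ᶠ b in U, Q a i b) :
    ∃ ν φ : ℕ → ℕ, StrictMono ν ∧ StrictMono φ ∧ (∀ n, P (ν n) (φ n)) ∧
      ∀ m n, m < n → Q (φ m) (ν n) (φ n) := by
  obtain ⟨g, hg, hg'⟩ := exists_seq_of_forall_finset_exists (α := ℕ × ℕ) (fun x => P x.1 x.2)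
    (fun x y => x.1 < y.1 ∧ x.2 < y.2 ∧ Q x.2 y.1 y.2) fun s _ => by
      set i := s.sup Prod.fst + 1
      obtain ⟨b, hb⟩ := ((hP i).and ((s.eventually_all.2 fun x _ => hQ x.2 i).and
        (hU (eventually_gt_atTop (s.sup Prod.snd))))).exists
      refine ⟨(i, b), hb.1, fun x hx => ⟨?_, ?_, hb.2.1 x hx⟩⟩
      · exact Nat.lt_succ_of_le (Finset.le_sup (f := Prod.fst) hx)
      · exact (Finset.le_sup (f := Prod.snd) hx).trans_lt hb.2.2
  exact ⟨fun n => (g n).1, fun n => (g n).2, fun m n h => (hg' m n h).1,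
    fun m n h => (hg' m n h).2.1, hg, fun m n h => (hg' m n h).2.2⟩

variable {Ω H : Type*} [MeasurableSpace Ω] {μ : Measure Ω} [IsProbabilityMeasure μ]
  [NormedAddCommGroup H] [InnerProductSpace ℝ H]

theorem exists_limits_normTrunc [CompleteSpace H] (U : Ultrafilter ℕ) {f : ℕ → Ω → H}
    (hf : ∀ n, StronglyMeasurable (f n)) (hint : ∀ n, Integrable (f n) μ) {C : ℝ}
    (hC : ∀ n, ∫ ω, ‖f n ω‖ ∂μ ≤ C) :
    ∃ (q : ℕ → ℝ) (h : ℕ → Ω → H), (∀ j, 0 ≤ q j) ∧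
      (Summable fun j : ℕ => ((j : ℝ) + 1) * q j) ∧
      (∀ j, Tendsto (fun n => μ.real (normShell (f n) j)) U (𝓝 (q j))) ∧
      (∀ K, MemLp (h K) 2 μ) ∧
      (∀ K, TendstoWeakL2 μ (fun n => normTrunc (f n) K) U (h K)) ∧
      (∀ K, ∫ ω, ‖h K ω‖ ^ 2 ∂μ ≤ ∑ j ∈ Finset.range K, ((j : ℝ) + 1) ^ 2 * q j) ∧
      ∀ K : ℕ, ∫ ω, ‖h (K + 1) ω - h K ω‖ ∂μ ≤ ((K : ℝ) + 1) * q K := by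
  have hq : ∀ j, ∃ x, Tendsto (fun n => μ.real (normShell (f n) j)) U (𝓝 x) := fun j => by
    obtain ⟨x, -, hx⟩ := (isCompact_Icc (a := (0 : ℝ)) (b := 1)).ultrafilter_le_nhds'
      (U.map fun n => μ.real (normShell (f n) j))
      (Filter.mem_map.2 (Filter.univ_mem' fun n => ⟨measureReal_nonneg, measureReal_le_one⟩))
    exact ⟨x, hx⟩
  choose q hq using hq
  have hh : ∀ K : ℕ, ∃ w, MemLp w 2 μ ∧ TendstoWeakL2 μ (fun n => normTrunc (f n) K) U w :=
    fun K => exists_tendstoWeakL2 U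
      (fun n => (stronglyMeasurable_normTrunc (hf n) K).aestronglyMeasurable)
      (fun n => norm_normTrunc_le (f n) K)
  choose h hmem hlim using hh
  have hq0 : ∀ j, 0 ≤ q j := fun j => ge_of_tendsto' (hq j) fun n => measureReal_nonneg
  have htr : ∀ K n, MemLp (normTrunc (f n) K) 2 μ := fun K n => memLp_normTrunc (hf n) K 2
  refine ⟨q, h, hq0, ?_, hq, hmem, hlim, fun K => ?_, fun K => ?_⟩
  · refine summable_of_sum_range_le (c := C + 1) (fun j => mul_nonneg (by positivity) (hq0 j))
      fun N => ?_
    refine le_of_tendsto' (tendsto_finsetSum _ fun j _ => (hq j).const_mul _) fun n =>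
      (sum_mul_measureReal_normShell_le (hf n) (hint n) N).trans ?_
    linarith [hC n]
  · exact (hlim K).integral_sq_norm_le (htr K) (hmem K)
      (tendsto_finsetSum _ fun j _ => (hq j).const_mul _)
      fun n => integral_sq_norm_normTrunc_le (hf n) K
  · exact ((hlim (K + 1)).sub (htr _) (htr _) (hmem _) (hmem _) (hlim K)).integral_norm_le
      (fun n => (htr _ n).sub (htr _ n)) ((hmem _).sub (hmem _)) ((hq K).const_mul _)
      fun n => integral_norm_normTrunc_succ_sub_le (hf n) K

theorem exists_subseq_quasiOrthogonal {U : Ultrafilter ℕ} (hU : (U : Filter ℕ) ≤ atTop)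
    {f : ℕ → Ω → H} (hf : ∀ n, StronglyMeasurable (f n)) {q : ℕ → ℝ} {h : ℕ → Ω → H}
    (hq : ∀ j, Tendsto (fun n => μ.real (normShell (f n) j)) U (𝓝 (q j)))
    (hmem : ∀ K, MemLp (h K) 2 μ)
    (hlim : ∀ K, TendstoWeakL2 μ (fun n => normTrunc (f n) K) U (h K)) :
    ∃ φ : ℕ → ℕ, StrictMono φ ∧
      (∀ n, ∀ j < 2 ^ n, μ.real (normShell (f (φ n)) j) ≤ q j + (1 / 4 : ℝ) ^ n) ∧
      ∀ m n, m < n → ∀ K ≤ 2 ^ n, ∀ L ≤ 2 ^ m,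
        |∫ ω, inner ℝ (normTrunc (f (φ n)) K ω - h K ω) (normTrunc (f (φ m)) L ω - h L ω) ∂μ| ≤
          (1 / 4 : ℝ) ^ n := by
  obtain ⟨ν, φ, hν, hφ, hP, hQ⟩ := exists_strictMono_of_eventually hU
    (P := fun i b => ∀ j < 2 ^ i, μ.real (normShell (f b) j) ≤ q j + (1 / 4 : ℝ) ^ i)
    (Q := fun a i b => ∀ K < 2 ^ i + 1, ∀ L < 2 ^ i + 1,
      |∫ ω, inner ℝ (normTrunc (f b) K ω - h K ω) (normTrunc (f a) L ω - h L ω) ∂μ| ≤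
          (1 / 4 : ℝ) ^ i)
    (fun i => (Set.finite_lt_nat _).eventually_all.2 fun j _ =>
      (hq j).eventually (eventually_le_nhds (lt_add_of_pos_right _ (by positivity))))
    (fun a i => (Set.finite_lt_nat _).eventually_all.2 fun K _ =>
      (Set.finite_lt_nat _).eventually_all.2 fun L _ => by
        have hy : MemLp (fun ω => normTrunc (f a) L ω - h L ω) 2 μ :=
          (memLp_normTrunc (hf a) L 2).sub (hmem L)
        have h1 : Tendsto (fun b => ∫ ω, inner ℝ (normTrunc (f b) K ω - h K ω)
            (normTrunc (f a) L ω - h L ω) ∂μ) U (𝓝 0) := by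
          have := ((hlim K).sub (fun n => memLp_normTrunc (hf n) K 2) (fun _ => hmem K) (hmem K)
            (hmem K) (fun _ _ => tendsto_const_nhds)) _ hy
          simpa using this
        have h2 := h1.abs
        rw [abs_zero] at h2
        exact h2.eventually (eventually_le_nhds (by positivity)))
  have hle : ∀ n, (1 / 4 : ℝ) ^ ν n ≤ (1 / 4 : ℝ) ^ n := fun n =>
    pow_le_pow_of_le_one (by norm_num) (by norm_num) (hν.id_le n)
  have hle2 : ∀ n, 2 ^ n ≤ 2 ^ ν n := fun n => Nat.pow_le_pow_right (by norm_num) (hν.id_le n)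
  refine ⟨φ, hφ, fun n j hj => (hP n j (hj.trans_le (hle2 n))).trans ?_,
    fun m n hmn K hK L hL => (hQ m n hmn K ?_ L ?_).trans (hle n)⟩
  · linarith [hle n]
  · exact Nat.lt_succ_of_le (hK.trans (hle2 n))
  · exact Nat.lt_succ_of_le (hL.trans ((Nat.pow_le_pow_right (by norm_num) hmn.le).trans (hle2 n)))

end Selection

section LacunaryKomlos

variable {Ω H : Type*} [MeasurableSpace Ω] {μ : Measure Ω} [IsProbabilityMeasure μ]
  [NormedAddCommGroup H]

theorem summable_half_pow_of_injective {σ : ℕ → ℕ} (hσ : Function.Injective σ) :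
    Summable fun k => (1 / 2 : ℝ) ^ σ k :=
  summable_geometric_two.comp_injective hσ

/-- If `μ (normShell (g n) j)` is at most `q j`, up to a small error, for `j < 2 ^ n`, then an
arbitrary rearrangement of `g` eventually agrees with its truncations. -/
theorem ae_eventually_normTrunc_eq {g : ℕ → Ω → H} (hint : ∀ n, Integrable (g n) μ) {C : ℝ}
    (hC : ∀ n, ∫ ω, ‖g n ω‖ ∂μ ≤ C) {q : ℕ → ℝ} (hq0 : ∀ j, 0 ≤ q j)
    (hqs : Summable fun j : ℕ => ((j : ℝ) + 1) * q j)
    (hq : ∀ n, ∀ j < 2 ^ n, μ.real (normShell (g n) j) ≤ q j + (1 / 4 : ℝ) ^ n)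
    {σ : ℕ → ℕ} (hσ : Function.Injective σ) :
    ∀ᵐ ω ∂μ, ∀ᶠ k in atTop, normTrunc (g (σ k)) (min k (2 ^ σ k)) ω = g (σ k) ω := by
  have hbound : ∀ k, μ.real {ω | min k (2 ^ σ k) ≤ ⌊‖g (σ k) ω‖⌋₊} ≤
      ∑ j ∈ Finset.Ico k (2 ^ σ k), q j + (1 + C) * (1 / 2 : ℝ) ^ σ k := fun k => by
    have h2 : (0 : ℝ) < 2 ^ σ k := by positivity
    refine (measureReal_le_floor_norm_le (hint (σ k)) (min k (2 ^ σ k))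
      (M := 2 ^ σ k) (by positivity)).trans ?_
    have hIco : Finset.Ico (min k (2 ^ σ k)) (2 ^ σ k) = Finset.Ico k (2 ^ σ k) := by
      ext j
      simp only [Finset.mem_Ico]
      omega
    have h1 : ∑ j ∈ Finset.Ico k (2 ^ σ k), μ.real (normShell (g (σ k)) j) ≤
        ∑ j ∈ Finset.Ico k (2 ^ σ k), q j + (1 / 2 : ℝ) ^ σ k := by
      calc _ ≤ ∑ j ∈ Finset.Ico k (2 ^ σ k), (q j + (1 / 4 : ℝ) ^ σ k) :=
            Finset.sum_le_sum fun j hj => hq _ j (Finset.mem_Ico.1 hj).2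
        _ = ∑ j ∈ Finset.Ico k (2 ^ σ k), q j + ((2 ^ σ k - k : ℕ) : ℝ) * (1 / 4 : ℝ) ^ σ k := by
            simp [Finset.sum_add_distrib]
        _ ≤ ∑ j ∈ Finset.Ico k (2 ^ σ k), q j + (2 : ℝ) ^ σ k * (1 / 4 : ℝ) ^ σ k := by
            gcongr
            exact_mod_cast Nat.sub_le _ _
        _ = _ := by
            rw [← mul_pow]; norm_num
    have h3 : (∫ ω, ‖g (σ k) ω‖ ∂μ) / ((2 ^ σ k : ℕ) : ℝ) ≤ C * (1 / 2 : ℝ) ^ σ k := by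
      rw [div_eq_mul_inv]
      push_cast
      rw [one_div, inv_pow]
      gcongr
      exact hC _
    rw [hIco]
    linarith
  have hsum : Summable fun k => μ.real {ω | min k (2 ^ σ k) ≤ ⌊‖g (σ k) ω‖⌋₊} :=
    ((summable_sum_Ico hq0 hqs _).add
      ((summable_half_pow_of_injective hσ).mul_left _)).of_nonneg_of_le
      (fun k => measureReal_nonneg) hbound
  have hne : ∑' k, μ {ω | min k (2 ^ σ k) ≤ ⌊‖g (σ k) ω‖⌋₊} ≠ ⊤ := by
    have := hsum.tsum_ofReal_ne_top
    simpa [ofReal_measureReal] using this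
  filter_upwards [ae_eventually_notMem hne] with ω hω
  filter_upwards [hω] with k hk
  have hk' : ⌊‖g (σ k) ω‖⌋₊ < min k (2 ^ σ k) := not_le.1 hk
  exact Set.indicator_of_mem (s := {ω | ⌊‖g (σ k) ω‖⌋₊ < min k (2 ^ σ k)}) hk' _

variable [InnerProductSpace ℝ H]

/-- The Komlós theorem along geometric scales. -/
theorem exists_subseq_ae_tendsto_floor_pow [CompleteSpace H] {f : ℕ → Ω → H}
    (hf : ∀ n, StronglyMeasurable (f n)) (hint : ∀ n, Integrable (f n) μ) {C : ℝ}
    (hC : ∀ n, ∫ ω, ‖f n ω‖ ∂μ ≤ C) :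
    ∃ F : Ω → H, Integrable F μ ∧ ∃ φ : ℕ → ℕ, StrictMono φ ∧
      ∀ σ : ℕ → ℕ, Function.Injective σ → ∀ c : ℝ, 1 < c → ∀ᵐ ω ∂μ,
        Tendsto (fun i : ℕ => (⌊c ^ i⌋₊ : ℝ)⁻¹ • ∑ k ∈ Finset.range ⌊c ^ i⌋₊, f (φ (σ k)) ω)
          atTop (𝓝 (F ω)) := by
  obtain ⟨q, h, hq0, hqs, hq, hmem, hlim, hsq, hL1⟩ :=
    exists_limits_normTrunc (μ := μ) (hyperfilter ℕ) hf hint hC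
  obtain ⟨φ, hφ, hqφ, hort⟩ :=
    exists_subseq_quasiOrthogonal Nat.hyperfilter_le_atTop hf hq hmem hlim
  have hhint : ∀ K, Integrable (h K) μ := fun K => (hmem K).integrable one_le_two
  have hds : Summable fun K => ∫ ω, ‖h (K + 1) ω - h K ω‖ ∂μ :=
    hqs.of_nonneg_of_le (fun K => integral_nonneg fun ω => norm_nonneg _) hL1
  have hdint : ∀ K, Integrable (fun ω => h (K + 1) ω - h K ω) μ := fun K =>
    (hhint _).sub (hhint _)
  have hdsum : ∀ᵐ ω ∂μ, HasSum (fun K => h (K + 1) ω - h K ω) (∑' K, (h (K + 1) ω - h K ω)) := by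
    filter_upwards [ae_summable_norm_of_summable_integral_norm hdint hds] with ω hω
    exact hω.of_norm.hasSum
  set F : Ω → H := fun ω => h 0 ω + ∑' K, (h (K + 1) ω - h K ω) with hF
  have hhF : ∀ᵐ ω ∂μ, Tendsto (fun K => h K ω) atTop (𝓝 (F ω)) := by
    filter_upwards [hdsum] with ω hω
    have := hω.tendsto_sum_nat.const_add (h 0 ω)
    simpa [Finset.sum_range_sub (fun K => h K ω)] using this
  refine ⟨F, (hhint 0).add (integrable_of_ae_hasSum hdint hds hdsum), φ, hφ,
    fun σ hσ c hc => ?_⟩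
  set κ : ℕ → ℕ := fun k => min k (2 ^ σ k) with hκ
  set Z : ℕ → Ω → H := fun k ω => normTrunc (f (φ (σ k))) (κ k) ω - h (κ k) ω with hZ
  have hκtop : Tendsto κ atTop atTop := by
    have h2 : Tendsto (fun k => 2 ^ σ k) atTop atTop :=
      (tendsto_pow_atTop_atTop_of_one_lt one_lt_two).comp hσ.nat_tendsto_atTop
    refine tendsto_atTop.2 fun b => ?_
    filter_upwards [eventually_ge_atTop b, h2.eventually_ge_atTop b] with k h1 h2
    exact le_min h1 h2
  have hZmem : ∀ k, MemLp (Z k) 2 μ := fun k =>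
    (memLp_normTrunc (hf _) _ 2).sub (hmem _)
  set v : ℕ → ℝ := fun k => 4 * (∑ j ∈ Finset.range k, ((j : ℝ) + 1) ^ 2 * q j) +
    2 * ((k : ℝ) + 1) ^ 2 * (1 / 2 : ℝ) ^ σ k with hv
  have hZv : ∀ k, ∫ ω, ‖Z k ω‖ ^ 2 ∂μ ≤ v k := fun k => by
    have hκk : κ k ≤ k := min_le_left _ _
    have hmono : ∑ j ∈ Finset.range (κ k), ((j : ℝ) + 1) ^ 2 * q j ≤
        ∑ j ∈ Finset.range k, ((j : ℝ) + 1) ^ 2 * q j :=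
      Finset.sum_le_sum_of_subset_of_nonneg (Finset.range_mono hκk) fun j _ _ =>
        mul_nonneg (by positivity) (hq0 j)
    have herr : ∑ j ∈ Finset.range (κ k), ((j : ℝ) + 1) ^ 2 * (1 / 4 : ℝ) ^ σ k ≤
        ((k : ℝ) + 1) ^ 2 * (1 / 2 : ℝ) ^ σ k := by
      calc _ ≤ ∑ j ∈ Finset.range (κ k), ((k : ℝ) + 1) ^ 2 * (1 / 4 : ℝ) ^ σ k := by
            refine Finset.sum_le_sum fun j hj => ?_
            have : (j : ℝ) ≤ k := by
              exact_mod_cast (Finset.mem_range.1 hj).le.trans hκk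
            gcongr
        _ = (κ k : ℝ) * (((k : ℝ) + 1) ^ 2 * (1 / 4 : ℝ) ^ σ k) := by simp
        _ ≤ (2 : ℝ) ^ σ k * (((k : ℝ) + 1) ^ 2 * (1 / 4 : ℝ) ^ σ k) := by
            gcongr
            exact_mod_cast min_le_right k (2 ^ σ k)
        _ = ((k : ℝ) + 1) ^ 2 * (2 * (1 / 4 : ℝ)) ^ σ k := by rw [mul_pow]; ring
        _ = _ := by norm_num
    have htr : ∫ ω, ‖normTrunc (f (φ (σ k))) (κ k) ω‖ ^ 2 ∂μ ≤
        ∑ j ∈ Finset.range k, ((j : ℝ) + 1) ^ 2 * q j + ((k : ℝ) + 1) ^ 2 * (1 / 2 : ℝ) ^ σ k := by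
      refine (integral_sq_norm_normTrunc_le (hf _) _).trans ?_
      calc _ ≤ ∑ j ∈ Finset.range (κ k), ((j : ℝ) + 1) ^ 2 * (q j + (1 / 4 : ℝ) ^ σ k) := by
            refine Finset.sum_le_sum fun j hj => ?_
            gcongr
            exact hqφ _ j ((Finset.mem_range.1 hj).trans_le (min_le_right _ _))
        _ ≤ _ := by
            simp only [mul_add, Finset.sum_add_distrib]
            exact add_le_add hmono herr
    calc ∫ ω, ‖Z k ω‖ ^ 2 ∂μ
        ≤ ∫ ω, (2 * ‖normTrunc (f (φ (σ k))) (κ k) ω‖ ^ 2 + 2 * ‖h (κ k) ω‖ ^ 2) ∂μ := by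
          refine integral_mono (hZmem k).integrable_norm_pow'
            (((memLp_normTrunc (hf _) _ 2).integrable_norm_pow'.const_mul _).add
              ((hmem _).integrable_norm_pow'.const_mul _)) fun ω => ?_
          have h1 := norm_sub_le (normTrunc (f (φ (σ k))) (κ k) ω) (h (κ k) ω)
          have h2 := sq_nonneg (‖normTrunc (f (φ (σ k))) (κ k) ω‖ - ‖h (κ k) ω‖)
          have h3 := pow_le_pow_left₀ (norm_nonneg _) h1 2
          simp only [hZ]
          nlinarith
      _ = 2 * ∫ ω, ‖normTrunc (f (φ (σ k))) (κ k) ω‖ ^ 2 ∂μ + 2 * ∫ ω, ‖h (κ k) ω‖ ^ 2 ∂μ := by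
          rw [integral_add ((memLp_normTrunc (hf _) _ 2).integrable_norm_pow'.const_mul _)
            ((hmem _).integrable_norm_pow'.const_mul _), integral_const_mul, integral_const_mul]
      _ ≤ v k := by
          simp only [hv]
          linarith [(hsq (κ k)).trans hmono]
  have hvs : Summable fun k => v k / ((k : ℝ) + 1) ^ 2 := by
    refine (((summable_div_sq_mul_sum_range hq0 hqs).mul_left 4).add
      ((summable_half_pow_of_injective hσ).mul_left 2)).congr fun k => ?_
    simp only [hv]
    field_simp
  have hlt : ∀ k l, σ l < σ k → |∫ ω, inner ℝ (Z k ω) (Z l ω) ∂μ| ≤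
      (1 / 2 : ℝ) ^ σ k * (1 / 2 : ℝ) ^ σ l := fun k l hkl => by
    refine (hort _ _ hkl (κ k) (min_le_right _ _) (κ l) (min_le_right _ _)).trans ?_
    calc (1 / 4 : ℝ) ^ σ k = (1 / 2 : ℝ) ^ σ k * (1 / 2 : ℝ) ^ σ k := by
          rw [← mul_pow]; norm_num
      _ ≤ _ := by
          gcongr ?_ * ?_
          exact pow_le_pow_of_le_one (by norm_num) (by norm_num) hkl.le
  have hquasi : ∀ k l, k ≠ l → |∫ ω, inner ℝ (Z k ω) (Z l ω) ∂μ| ≤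
      (1 / 2 : ℝ) ^ σ k * (1 / 2 : ℝ) ^ σ l := fun k l hkl => by
    rcases lt_or_gt_of_ne (hσ.ne hkl) with hlt' | hlt'
    · simp only [fun ω => real_inner_comm (Z l ω) (Z k ω)]
      rw [mul_comm]
      exact hlt l k hlt'
    · exact hlt k l hlt'
  filter_upwards [ae_tendsto_floor_pow_of_quasiOrthogonal hZmem (fun k => by positivity)
    (summable_half_pow_of_injective hσ) hZv hquasi hvs hc, hhF,
    ae_eventually_normTrunc_eq (g := fun n => f (φ n)) (fun n => hint _) (fun n => hC _) hq0 hqs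
      hqφ hσ] with ω hZω hFω htrω
  have hrest : Tendsto (fun k => f (φ (σ k)) ω - Z k ω) atTop (𝓝 (F ω)) := by
    refine (hFω.comp hκtop).congr' ?_
    filter_upwards [htrω] with k hk
    simp only [hZ, Function.comp_apply, hκ, hk]
    abel
  have hfloor : Tendsto (fun i : ℕ => ⌊c ^ i⌋₊) atTop atTop :=
    tendsto_nat_floor_atTop.comp (tendsto_pow_atTop_atTop_of_one_lt hc)
  have := (hrest.cesaro_smul.comp hfloor).add hZω
  rw [add_zero] at this
  refine this.congr fun i => ?_
  simp only [Function.comp_apply]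
  rw [← smul_add, ← Finset.sum_add_distrib]
  simp

/-- The Komlós theorem for strongly measurable functions and injective rearrangements. -/
theorem exists_subseq_ae_tendsto_cesaro_of_injective [CompleteSpace H] {f : ℕ → Ω → H}
    (hf : ∀ n, StronglyMeasurable (f n)) (hint : ∀ n, Integrable (f n) μ) {C : ℝ}
    (hC : ∀ n, ∫ ω, ‖f n ω‖ ∂μ ≤ C) :
    ∃ F : Ω → H, Integrable F μ ∧ ∃ φ : ℕ → ℕ, StrictMono φ ∧
      ∀ σ : ℕ → ℕ, Function.Injective σ → ∀ᵐ ω ∂μ,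
        Tendsto (fun n : ℕ => (n : ℝ)⁻¹ • ∑ k ∈ Finset.range n, f (φ (σ k)) ω)
          atTop (𝓝 (F ω)) := by
  obtain ⟨F, hF, φ, hφ, hlim⟩ := exists_subseq_ae_tendsto_floor_pow hf hint hC
  obtain ⟨R, -, χ, hχ, hlimR⟩ := exists_subseq_ae_tendsto_floor_pow (μ := μ)
    (f := fun n ω => ‖f (φ n) ω‖) (C := C) (fun n => (hf _).norm) (fun n => (hint _).norm)
    (fun n => by simpa using hC (φ n))
  refine ⟨F, hF, φ ∘ χ, hφ.comp hχ, fun σ hσ => ?_⟩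
  have hc1 : ∀ m : ℕ, (1 : ℝ) < 1 + 1 / ((m : ℝ) + 1) := fun m =>
    lt_add_of_pos_right _ Nat.one_div_pos_of_nat
  have h1 := ae_all_iff.2 fun m : ℕ => hlim (χ ∘ σ) (hχ.injective.comp hσ) _ (hc1 m)
  have h2 := ae_all_iff.2 fun m : ℕ => hlimR σ hσ _ (hc1 m)
  filter_upwards [h1, h2] with ω hω hRω
  refine tendsto_inv_smul_sum_of_exists_subseq (R := R ω) ?_ fun a ha => ?_
  · refine tendsto_div_of_monotone_of_tendsto_div_floor_pow _ _ ?_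
      (fun m => 1 + 1 / ((m : ℝ) + 1)) hc1 ?_ fun m => ?_
    · exact monotone_nat_of_le_succ fun n => by
        rw [Finset.sum_range_succ]; linarith [norm_nonneg (f ((φ ∘ χ) (σ n)) ω)]
    · simpa using tendsto_one_div_add_atTop_nhds_zero_nat (𝕜 := ℝ) |>.const_add 1
    · simpa [div_eq_inv_mul] using hRω m
  · obtain ⟨m, hm⟩ := exists_subseq_floor_pow_le ha
    exact ⟨fun n => ⌊(1 + 1 / ((m : ℝ) + 1)) ^ n⌋₊, hm,
      tendsto_nat_floor_atTop.comp (tendsto_pow_atTop_atTop_of_one_lt (hc1 m)), hω m⟩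

end LacunaryKomlos

/-- Permutation-invariant Komlós theorem for Hilbert-space-valued functions:
every `L¹`-bounded sequence in `L¹(μ; H)` has a subsequence `g` such that
the Cesàro means of every permuted subsequence of `g` converge a.e. to a fixed
integrable function `F`. -/
theorem komlos_hilbert_perm_invariant
    {Ω : Type*} [MeasurableSpace Ω] (μ : Measure Ω) [IsProbabilityMeasure μ]
    {H : Type*} [NormedAddCommGroup H] [InnerProductSpace ℝ H] [CompleteSpace H]
    (f : ℕ → Ω → H) (hint : ∀ n, Integrable (f n) μ)
    (hbd : ∃ C : ℝ, ∀ n, ∫ ω, ‖f n ω‖ ∂μ ≤ C) :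
    ∃ (F : Ω → H), Integrable F μ ∧ ∃ φ : ℕ → ℕ, StrictMono φ ∧
      ∀ ψ : ℕ → ℕ, StrictMono ψ → ∀ π : ℕ → ℕ, Function.Bijective π →
        ∀ᵐ ω ∂μ, Tendsto
          (fun n : ℕ => (n : ℝ)⁻¹ • ∑ k ∈ Finset.range n, f (φ (ψ (π k))) ω)
          atTop (𝓝 (F ω)) := by
  obtain ⟨C, hC⟩ := hbd
  have hae : ∀ n, f n =ᵐ[μ] (hint n).1.mk (f n) := fun n => (hint n).1.ae_eq_mk
  obtain ⟨F, hF, φ, hφ, hlim⟩ := exists_subseq_ae_tendsto_cesaro_of_injective (μ := μ)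
    (f := fun n => (hint n).1.mk (f n)) (C := C) (fun n => (hint n).1.stronglyMeasurable_mk)
    (fun n => (hint n).congr (hae n))
    (fun n => (integral_congr_ae ((hae n).fun_comp norm)).symm.trans_le (hC n))
  refine ⟨F, hF, φ, hφ, fun ψ hψ π hπ => ?_⟩
  filter_upwards [hlim (ψ ∘ π) (hψ.injective.comp hπ.injective), ae_all_iff.2 hae] with ω hω heq
  simpa only [heq, Function.comp_apply] using hω
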